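/- Assume ψ(x, 0) = 0 for every x ∈ E, and that the weights w satisfy w(r) = 1 for every fact (v, r, v') ∈ G* and w(r) = 0 for every fact (v, r, v') ∈ G \ G*. Then the reasoning process of the weighted GNN over G is the optimal reasoning process over G*: for every layer l with 1 ≤ l ≤ L and every node v, h_{G,w}(l, v) = h_{G*}(l, v); moreover, every node u that appears (as head or tail) in no fact of G* satisfies h_{G,w}(l, u) = 0 for all l ≥ 1, i.e., nodes outside the ground-truth subgraph do not contribute to the reasoning process. -/

import Mathlib

/-- The weighted GNN node representations over a finite fact set `H`:
`h(0, v) = h0 v` and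
`h(l+1, v) = ψ (h(l, v)) (∑_{f ∈ N_v(H)} w (rel f) • m (l+1) f)`,
where `N_v(H)` is the set of facts in `H` with head `v`.
The unweighted GNN over `H` is the weighted GNN with `w ≡ 1`. -/
noncomputable def gnnRep {V R E : Type*} [DecidableEq V] [DecidableEq R]
    [AddCommMonoid E] [Module ℝ E]
    (H : Finset (V × R × V)) (h0 : V → E) (ψ : E → E → E)
    (m : ℕ → (V × R × V) → E) (w : R → ℝ) : ℕ → V → E
  | 0, v => h0 v
  | l + 1, v =>
      ψ (gnnRep H h0 ψ m w l v)
        (∑ f ∈ H.filter (fun f => f.1 = v), w f.2.1 • m (l + 1) f)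

/-- Relevance weights that are `1` on `S` and `0` on `H \ S` turn the weighted message aggregation
over `H` into the unweighted aggregation over `S`. -/
theorem sum_relevance_smul_eq {V R E : Type*} [DecidableEq V] [DecidableEq R]
    [AddCommMonoid E] [Module ℝ E] {H S : Finset (V × R × V)} (hsub : S ⊆ H) {w : R → ℝ}
    (hw1 : ∀ f ∈ S, w f.2.1 = 1) (hw0 : ∀ f ∈ H \ S, w f.2.1 = 0)
    (g : V × R × V → E) (v : V) :
    ∑ f ∈ H.filter (fun f => f.1 = v), w f.2.1 • g f =
      ∑ f ∈ S.filter (fun f => f.1 = v), (1 : ℝ) • g f := by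
  rw [← Finset.sum_subset (Finset.filter_subset_filter _ hsub)]
  · refine Finset.sum_congr rfl fun f hf => ?_
    rw [hw1 f (Finset.mem_filter.1 hf).1]
  · intro f hf hfS
    obtain ⟨hfH, hfv⟩ := Finset.mem_filter.1 hf
    rw [hw0 f (Finset.mem_sdiff.2 ⟨hfH, fun h => hfS (Finset.mem_filter.2 ⟨h, hfv⟩)⟩), zero_smul]

/-- With such weights, the weighted GNN over `H` agrees with the unweighted GNN over `S`. -/
theorem gnnRep_eq_of_relevance {V R E : Type*} [DecidableEq V] [DecidableEq R]
    [AddCommMonoid E] [Module ℝ E] {H S : Finset (V × R × V)} (hsub : S ⊆ H) {w : R → ℝ}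
    (hw1 : ∀ f ∈ S, w f.2.1 = 1) (hw0 : ∀ f ∈ H \ S, w f.2.1 = 0)
    (h0 : V → E) (ψ : E → E → E) (m : ℕ → (V × R × V) → E) (l : ℕ) (v : V) :
    gnnRep H h0 ψ m w l v = gnnRep S h0 ψ m (fun _ => 1) l v := by
  induction l with
  | zero => rfl
  | succ l ih => rw [gnnRep, gnnRep, ih, sum_relevance_smul_eq hsub hw1 hw0]

/-- A node that is the head of no fact has zero representation at every positive layer. -/
theorem gnnRep_succ_eq_zero {V R E : Type*} [DecidableEq V] [DecidableEq R]
    [AddCommMonoid E] [Module ℝ E] {H : Finset (V × R × V)} (h0 : V → E) {ψ : E → E → E}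
    (m : ℕ → (V × R × V) → E) (w : R → ℝ) (hψ : ∀ x : E, ψ x 0 = 0) {u : V}
    (hu : ∀ f ∈ H, f.1 ≠ u) (l : ℕ) :
    gnnRep H h0 ψ m w (l + 1) u = 0 := by
  rw [gnnRep, Finset.filter_false_of_mem hu, Finset.sum_empty, hψ]

/-- Suppose `ψ x 0 = 0` for all `x`, and the weights `w` are `1` on the
relations of facts of the ground-truth subgraph `G* ⊆ G` and `0` on the
relations of facts of `G \ G*`.  Then the reasoning process of the weighted
GNN over `G` is the optimal reasoning process over `G*`: for every layer
`1 ≤ l ≤ L` and node `v`, `h_{G,w}(l, v) = h_{G*}(l, v)`; moreover, every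
node `u` that appears in no fact of `G*` (neither as head nor tail)
satisfies `h_{G,w}(l, u) = 0` for all `l ≥ 1`. -/
theorem optimal_reasoning_process {V R E : Type*} [DecidableEq V] [DecidableEq R]
    [AddCommMonoid E] [Module ℝ E]
    (G Gstar : Finset (V × R × V)) (hsub : Gstar ⊆ G)
    (h0 : V → E) (ψ : E → E → E)
    (m : ℕ → (V × R × V) → E) (w : R → ℝ) (L : ℕ)
    (hψ : ∀ x : E, ψ x 0 = 0)
    (hw1 : ∀ f ∈ Gstar, w f.2.1 = 1)
    (hw0 : ∀ f ∈ G \ Gstar, w f.2.1 = 0) :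
    (∀ l, 1 ≤ l → l ≤ L → ∀ v : V,
        gnnRep G h0 ψ m w l v = gnnRep Gstar h0 ψ m (fun _ => 1) l v) ∧
    (∀ u : V, (∀ f ∈ Gstar, f.1 ≠ u ∧ f.2.2 ≠ u) →
        ∀ l, 1 ≤ l → gnnRep G h0 ψ m w l u = 0) := by
  refine ⟨fun l _ _ v => gnnRep_eq_of_relevance hsub hw1 hw0 h0 ψ m l v, fun u hu l hl => ?_⟩
  obtain ⟨k, rfl⟩ := Nat.exists_eq_add_of_le' hl
  rw [gnnRep_eq_of_relevance hsub hw1 hw0]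
  exact gnnRep_succ_eq_zero h0 m _ hψ (fun f hf => (hu f hf).1) k
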